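/- Let G be a finite simple graph and let B = V(G) \ (α_core(G) ∪ τ_core(G)). Then the induced subgraph G[B] satisfies α(G[B]) = α(G) − |α_core(G)| and τ(G[B]) = τ(G) − |τ_core(G)|. -/

import Mathlib

/-- A set of vertices is stable (independent) if no two of its vertices are adjacent. -/
def IsStable {V : Type*} (G : SimpleGraph V) (S : Set V) : Prop :=
  ∀ ⦃u⦄, u ∈ S → ∀ ⦃v⦄, v ∈ S → ¬ G.Adj u v

/-- A set of vertices is a vertex cover if it meets every edge. -/
def IsCover {V : Type*} (G : SimpleGraph V) (C : Set V) : Prop :=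
  ∀ ⦃u v⦄, G.Adj u v → u ∈ C ∨ v ∈ C

/-- The stability number α(G): the maximum size of a stable set. -/
noncomputable def alphaNum {V : Type*} (G : SimpleGraph V) : ℕ :=
  sSup {n | ∃ S : Set V, IsStable G S ∧ S.ncard = n}

/-- The vertex covering number τ(G): the minimum size of a vertex cover. -/
noncomputable def tauNum {V : Type*} (G : SimpleGraph V) : ℕ :=
  sInf {n | ∃ C : Set V, IsCover G C ∧ C.ncard = n}

/-- An inclusionwise maximal stable set. -/
def IsMaximalStable {V : Type*} (G : SimpleGraph V) (S : Set V) : Prop :=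
  IsStable G S ∧ ∀ T : Set V, IsStable G T → S ⊆ T → S = T

/-- The σ_v-cover number: the maximum m such that every vertex belongs to a
maximal stable set with at least m vertices. -/
noncomputable def sigmaV {V : Type*} (G : SimpleGraph V) : ℕ :=
  sSup {m | ∀ v : V, ∃ S : Set V, v ∈ S ∧ IsMaximalStable G S ∧ m ≤ S.ncard}

/-- α_core(G): the intersection of all maximum stable sets of G. -/
def alphaCore {V : Type*} (G : SimpleGraph V) : Set V :=
  {v | ∀ S : Set V, IsStable G S → S.ncard = alphaNum G → v ∈ S}

/-- τ_core(G): the intersection of all minimum vertex covers of G. -/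
def tauCore {V : Type*} (G : SimpleGraph V) : Set V :=
  {v | ∀ C : Set V, IsCover G C → C.ncard = tauNum G → v ∈ C}

theorem IsStable.isCover_compl {V : Type*} {G : SimpleGraph V} {S : Set V}
    (hS : IsStable G S) : IsCover G Sᶜ := by
  intro u v huv
  by_contra! h
  exact hS (Set.notMem_compl_iff.mp h.1) (Set.notMem_compl_iff.mp h.2) huv

theorem IsCover.isStable_compl {V : Type*} {G : SimpleGraph V} {C : Set V}
    (hC : IsCover G C) : IsStable G Cᶜ :=
  fun _ hu _ hv huv => (hC huv).elim hu hv

theorem IsStable.subset {V : Type*} {G : SimpleGraph V} {S T : Set V}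
    (hT : IsStable G T) (h : S ⊆ T) : IsStable G S :=
  fun _ hu _ hv => hT (h hu) (h hv)

theorem bddAbove_ncard_isStable {V : Type*} [Finite V] (G : SimpleGraph V) :
    BddAbove {n | ∃ S : Set V, IsStable G S ∧ S.ncard = n} := by
  refine ⟨Nat.card V, ?_⟩
  rintro _ ⟨S, -, rfl⟩
  exact Set.ncard_le_card S

theorem IsStable.ncard_le_alphaNum {V : Type*} [Finite V] {G : SimpleGraph V} {S : Set V}
    (hS : IsStable G S) : S.ncard ≤ alphaNum G :=
  le_csSup (bddAbove_ncard_isStable G) ⟨S, hS, rfl⟩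

theorem exists_isStable_ncard_eq_alphaNum {V : Type*} [Finite V] (G : SimpleGraph V) :
    ∃ S : Set V, IsStable G S ∧ S.ncard = alphaNum G :=
  Nat.sSup_mem (s := {n | ∃ S : Set V, IsStable G S ∧ S.ncard = n})
    ⟨0, ∅, fun _ hu => hu.elim, Set.ncard_empty V⟩ (bddAbove_ncard_isStable G)

theorem IsCover.tauNum_le_ncard {V : Type*} {G : SimpleGraph V} {C : Set V}
    (hC : IsCover G C) : tauNum G ≤ C.ncard :=
  Nat.sInf_le ⟨C, hC, rfl⟩

theorem exists_isCover_ncard_eq_tauNum {V : Type*} (G : SimpleGraph V) :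
    ∃ C : Set V, IsCover G C ∧ C.ncard = tauNum G :=
  Nat.sInf_mem (s := {n | ∃ C : Set V, IsCover G C ∧ C.ncard = n})
    ⟨_, Set.univ, fun u _ _ => Or.inl (Set.mem_univ u), rfl⟩

theorem alphaNum_add_tauNum {V : Type*} [Finite V] (G : SimpleGraph V) :
    alphaNum G + tauNum G = Nat.card V := by
  obtain ⟨S, hS, hSc⟩ := exists_isStable_ncard_eq_alphaNum G
  obtain ⟨C, hC, hCc⟩ := exists_isCover_ncard_eq_tauNum G
  have h₁ := hS.isCover_compl.tauNum_le_ncard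
  have h₂ := hC.isStable_compl.ncard_le_alphaNum
  have h₃ := Set.ncard_add_ncard_compl S
  have h₄ := Set.ncard_add_ncard_compl C
  omega

theorem mem_tauCore_iff {V : Type*} [Finite V] {G : SimpleGraph V} {v : V} :
    v ∈ tauCore G ↔ ∀ S : Set V, IsStable G S → S.ncard = alphaNum G → v ∉ S := by
  have hsum := alphaNum_add_tauNum G
  constructor
  · intro hv S hS hSc
    have h := Set.ncard_add_ncard_compl S
    exact hv Sᶜ hS.isCover_compl (by omega)
  · intro hv C hC hCc
    have h := Set.ncard_add_ncard_compl C
    exact Set.notMem_compl_iff.mp (hv Cᶜ hC.isStable_compl (by omega))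

theorem disjoint_alphaCore_tauCore {V : Type*} [Finite V] (G : SimpleGraph V) :
    Disjoint (alphaCore G) (tauCore G) := by
  obtain ⟨S, hS, hSc⟩ := exists_isStable_ncard_eq_alphaNum G
  exact Set.disjoint_left.mpr fun v hA hT => mem_tauCore_iff.mp hT S hS hSc (hA S hS hSc)

/-- Every neighbour of a vertex of the stable core lies in the covering core. -/
theorem mem_tauCore_of_adj {V : Type*} [Finite V] {G : SimpleGraph V} {u v : V}
    (hu : u ∈ alphaCore G) (huv : G.Adj u v) : v ∈ tauCore G :=
  mem_tauCore_iff.mpr fun S hS hSc hv => hS (hu S hS hSc) hv huv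

theorem isStable_alphaCore {V : Type*} [Finite V] (G : SimpleGraph V) :
    IsStable G (alphaCore G) := by
  obtain ⟨S, hS, hSc⟩ := exists_isStable_ncard_eq_alphaNum G
  exact hS.subset fun v hv => hv S hS hSc

theorem IsStable.union_alphaCore {V : Type*} [Finite V] {G : SimpleGraph V} {T : Set V}
    (hT : IsStable G T) (hd : Disjoint T (tauCore G)) : IsStable G (T ∪ alphaCore G) := by
  rintro u (hu | hu) v (hv | hv) huv
  · exact hT hu hv huv
  · exact Set.disjoint_left.mp hd hu (mem_tauCore_of_adj hv huv.symm)
  · exact Set.disjoint_left.mp hd hv (mem_tauCore_of_adj hu huv)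
  · exact isStable_alphaCore G hu hv huv

theorem IsStable.image_val {V : Type*} {G : SimpleGraph V} {B : Set V} {T : Set B}
    (hT : IsStable (G.induce B) T) : IsStable G (Subtype.val '' T) := by
  rintro _ ⟨u, hu, rfl⟩ _ ⟨v, hv, rfl⟩ huv
  exact hT hu hv huv

theorem IsStable.ncard_le_alphaNum_induce {V : Type*} [Finite V] {G : SimpleGraph V}
    {S B : Set V} (hS : IsStable G S) (h : S ⊆ B) : S.ncard ≤ alphaNum (G.induce B) := by
  have hst : IsStable (G.induce B) (Subtype.val ⁻¹' S) := fun _ hu _ hv huv => hS hu hv huv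
  have hle := hst.ncard_le_alphaNum
  rwa [Set.ncard_preimage_of_injective_subset_range Subtype.val_injective
    (by simpa using h)] at hle

theorem alphaNum_induce_add_ncard_alphaCore {V : Type*} [Finite V] (G : SimpleGraph V) :
    alphaNum (G.induce (alphaCore G ∪ tauCore G)ᶜ) + (alphaCore G).ncard = alphaNum G := by
  apply le_antisymm
  · obtain ⟨T, hT, hTc⟩ :=
      exists_isStable_ncard_eq_alphaNum (G.induce (alphaCore G ∪ tauCore G)ᶜ)
    have hsub : Subtype.val '' T ⊆ (alphaCore G ∪ tauCore G)ᶜ := by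
      rintro _ ⟨u, -, rfl⟩
      exact u.2
    have hdis := Set.disjoint_union_right.mp (Set.disjoint_left.mpr hsub)
    rw [← hTc, ← Set.ncard_image_of_injective T Subtype.val_injective,
      ← Set.ncard_union_eq hdis.1]
    exact (hT.image_val.union_alphaCore hdis.2).ncard_le_alphaNum
  · obtain ⟨S, hS, hSc⟩ := exists_isStable_ncard_eq_alphaNum G
    have hA : alphaCore G ⊆ S := fun v hv => hv S hS hSc
    rw [← hSc, ← Set.ncard_sdiff_add_ncard_of_subset hA]
    refine Nat.add_le_add_right ((hS.subset Set.sdiff_subset).ncard_le_alphaNum_induce ?_) _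
    rintro v ⟨hv, hvA⟩ (h | h)
    · exact hvA h
    · exact mem_tauCore_iff.mp h S hS hSc hv

/-- Let B = V(G) \ (α_core(G) ∪ τ_core(G)).  Then
α(G[B]) = α(G) − |α_core(G)| and τ(G[B]) = τ(G) − |τ_core(G)|. -/
theorem stmt_5 {V : Type*} [Fintype V] (G : SimpleGraph V)
    (B : Set V) (hB : B = (alphaCore G ∪ tauCore G)ᶜ) :
    alphaNum (G.induce B) = alphaNum G - (alphaCore G).ncard ∧
    tauNum (G.induce B) = tauNum G - (tauCore G).ncard := by
  subst hB
  have hα := alphaNum_induce_add_ncard_alphaCore G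
  have hG := alphaNum_add_tauNum G
  have hB := alphaNum_add_tauNum (G.induce (alphaCore G ∪ tauCore G)ᶜ)
  rw [Nat.card_coe_set_eq] at hB
  have hc := Set.ncard_add_ncard_compl (alphaCore G ∪ tauCore G)
  rw [Set.ncard_union_eq (disjoint_alphaCore_tauCore G)] at hc
  omega
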